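/- arXiv:0903.5147 — 2 statements merged into one kernel-verified Lean document; each statement's English description precedes it below -/
import Mathlib

section
/- Let X = μ + Z with Z ~ N(0,1), let \hat{μ}(X) = (1 − λ/X²)_+ X be the nonnegative garrote estimator with threshold λ = 2 log d (d ≥ 2). Then the risk satisfies E(\hat{μ}(X) − μ)² ≤ μ² ∧ (2 log d) + C (log d)^{−1/2} d^{−1} for some absolute constant C > 0. -/
open MeasureTheory ProbabilityTheory

/-- The nonnegative garrote with threshold `t ^ 2`. -/
noncomputable def garrote (t x : ℝ) : ℝ := max (1 - t ^ 2 / x ^ 2) 0 * x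

lemma garrote_of_abs_le {t x : ℝ} (h : |x| ≤ t) : garrote t x = 0 := by
  rcases eq_or_ne x 0 with rfl | hx
  · simp [garrote]
  · have hx2 : 0 < x ^ 2 := by positivity
    have h1 : 1 ≤ t ^ 2 / x ^ 2 := by
      rw [le_div_iff₀ hx2, one_mul]
      exact sq_le_sq.2 (h.trans (le_abs_self t))
    simp [garrote, max_eq_right (sub_nonpos.2 h1)]

lemma garrote_of_le_abs {t x : ℝ} (ht : 0 < t) (h : t ≤ |x|) :
    garrote t x = x - t ^ 2 / x := by
  have hx : x ≠ 0 := abs_pos.1 (ht.trans_le h)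
  have hx2 : 0 < x ^ 2 := by positivity
  have h1 : t ^ 2 / x ^ 2 ≤ 1 := by
    rw [div_le_one hx2]
    exact sq_le_sq.2 (by rwa [abs_of_pos ht])
  rw [garrote, max_eq_left (sub_nonneg.2 h1)]
  field_simp

lemma garrote_neg (t x : ℝ) : garrote t (-x) = -garrote t x := by
  simp [garrote]

lemma sq_garrote_sub_self_le {t : ℝ} (ht : 0 < t) (x : ℝ) :
    (garrote t x - x) ^ 2 ≤ t ^ 2 := by
  rcases le_total |x| t with h | h
  · rw [garrote_of_abs_le h, zero_sub, neg_sq]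
    exact sq_le_sq.2 (h.trans (le_abs_self t))
  · have hx : 0 < |x| := ht.trans_le h
    have hx2 : t ^ 2 ≤ x ^ 2 := sq_le_sq.2 (by rwa [abs_of_pos ht])
    have hpos : 0 < x ^ 2 := by have := abs_pos.1 hx; positivity
    rw [garrote_of_le_abs ht h, show x - t ^ 2 / x - x = -(t ^ 2 / x) by ring, neg_sq, div_pow,
      div_le_iff₀ hpos]
    nlinarith [sq_nonneg t]

lemma sq_garrote_sub_self_le_of_add_one_le {t : ℝ} (ht : 2 ≤ t) {x : ℝ} (h : t + 1 ≤ x) :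
    (garrote t x - x) ^ 2 ≤ t ^ 2 - t := by
  have hx : 0 < x := by linarith
  rw [garrote_of_le_abs (by linarith) (by rw [abs_of_pos hx]; linarith),
    show x - t ^ 2 / x - x = -(t ^ 2 / x) by ring, neg_sq, div_pow, div_le_iff₀ (by positivity)]
  have h1 : (t + 1) ^ 2 ≤ x ^ 2 := by gcongr
  have h2 : 0 ≤ t ^ 2 - t := by nlinarith
  have h3 := mul_le_mul_of_nonneg_left h1 h2
  nlinarith [mul_nonneg (by linarith : (0 : ℝ) ≤ t) (by nlinarith : (0 : ℝ) ≤ t ^ 2 - t - 1)]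

/-- `garrote t` grows with slope at most `2` seen from a point beyond the threshold. -/
lemma garrote_sub_mul_sub_le {t m : ℝ} (ht : 0 < t) (hm : t ≤ m) (x : ℝ) :
    (garrote t x - garrote t m) * (x - m) ≤ 2 * (x - m) ^ 2 := by
  have hm0 : 0 < m := ht.trans_le hm
  have hgm : garrote t m = m - t ^ 2 / m := garrote_of_le_abs ht (by rwa [abs_of_pos hm0])
  rcases le_total |x| t with h | h
  · have hxt : x ≤ t := (le_abs_self x).trans h
    have h2 : garrote t m ≤ 2 * (m - t) := by
      have : 2 * (m - t) - (m - t ^ 2 / m) = (m - t) ^ 2 / m := by field_simp; ring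
      have h3 : 0 ≤ (m - t) ^ 2 / m := by positivity
      linarith
    rw [garrote_of_abs_le h]
    nlinarith
  · have hx : x ≠ 0 := abs_pos.1 (ht.trans_le h)
    have hle : t ^ 2 / (x * m) ≤ 1 := by
      rcases lt_or_gt_of_ne hx with hneg | hpos
      · exact (div_nonpos_of_nonneg_of_nonpos (sq_nonneg t)
          (mul_neg_of_neg_of_pos hneg hm0).le).trans zero_le_one
      · rw [div_le_one (by positivity)]
        rw [abs_of_pos hpos] at h
        nlinarith
    rw [garrote_of_le_abs ht h, hgm,
      show (x - t ^ 2 / x - (m - t ^ 2 / m)) * (x - m) = (1 + t ^ 2 / (x * m)) * (x - m) ^ 2 by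
        field_simp; ring]
    exact mul_le_mul_of_nonneg_right (by linarith) (sq_nonneg _)

lemma mul_exp_neg_sq_le (y : ℝ) : y * Real.exp (-y ^ 2 / 8) ≤ 4 * Real.exp (-y ^ 2 / 16) := by
  have h1 : y / 4 ≤ Real.exp (y ^ 2 / 16) := by
    have := Real.add_one_le_exp (y ^ 2 / 16)
    nlinarith [sq_nonneg (y / 4 - 1)]
  calc y * Real.exp (-y ^ 2 / 8)
      ≤ 4 * Real.exp (y ^ 2 / 16) * Real.exp (-y ^ 2 / 8) := by
        gcongr; linarith
    _ = 4 * Real.exp (-y ^ 2 / 16) := by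
        rw [mul_assoc, ← Real.exp_add]; congr 2; ring

lemma mul_exp_neg_mul_le {t : ℝ} (ht : 0 < t) (u : ℝ) : u * Real.exp (-(t * u) / 2) ≤ 2 / t := by
  have h1 : u * t / 2 ≤ Real.exp (t * u / 2) := by
    have := Real.add_one_le_exp (t * u / 2)
    linarith
  rw [neg_div, Real.exp_neg, ← div_eq_mul_inv, div_le_div_iff₀ (Real.exp_pos _) ht]
  linarith

lemma garrote_excess_mul_exp_le_of_le {t x : ℝ} (m : ℝ) (ht : 0 < t) (h : t ≤ x) :
    (garrote t x * (garrote t x - 2 * m)) * Real.exp (-(x - m) ^ 2 / 2) ≤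
      8 / t * Real.exp (-t ^ 2 / 2) * Real.exp (-(x - t) ^ 2 / 16) := by
  have hx : 0 < x := ht.trans_le h
  have hg : garrote t x = x - t ^ 2 / x := garrote_of_le_abs ht (by rwa [abs_of_pos hx])
  set y := garrote t x with hy
  have hyx : x - t ≤ y := by
    have : t ^ 2 / x ≤ t := by rw [div_le_iff₀ hx]; nlinarith
    linarith
  have hy0 : 0 ≤ y := by linarith
  rcases le_total (y - 2 * m) 0 with hu | hu
  · exact (mul_nonpos_of_nonpos_of_nonneg (mul_nonpos_of_nonneg_of_nonpos hy0 hu)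
      (Real.exp_pos _).le).trans (by positivity)
  · set u := y - 2 * m with hu_def
    have hsq : (x - y / 2) ^ 2 = t ^ 2 + y ^ 2 / 4 := by
      rw [hg]; field_simp; ring
    have hA : t ≤ x - y / 2 := by
      refine le_of_sq_le_sq ?_ ?_
      · nlinarith
      · have : 0 ≤ t ^ 2 / x := by positivity
        linarith
    have hexp : -(x - m) ^ 2 / 2 ≤ -t ^ 2 / 2 + (-y ^ 2 / 8 + -(t * u) / 2) := by
      have : x - m = (x - y / 2) + u / 2 := by rw [hu_def]; ring
      rw [this]
      nlinarith [mul_le_mul_of_nonneg_right hA hu, sq_nonneg u]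
    calc y * u * Real.exp (-(x - m) ^ 2 / 2)
        ≤ y * u * Real.exp (-t ^ 2 / 2 + (-y ^ 2 / 8 + -(t * u) / 2)) := by gcongr
      _ = Real.exp (-t ^ 2 / 2) * ((y * Real.exp (-y ^ 2 / 8)) *
            (u * Real.exp (-(t * u) / 2))) := by
          rw [Real.exp_add, Real.exp_add]; ring
      _ ≤ Real.exp (-t ^ 2 / 2) * ((4 * Real.exp (-y ^ 2 / 16)) * (2 / t)) := by
          refine mul_le_mul_of_nonneg_left ?_ (Real.exp_pos _).le
          exact mul_le_mul (mul_exp_neg_sq_le y) (mul_exp_neg_mul_le ht u) (by positivity)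
            (by positivity)
      _ = 8 / t * Real.exp (-t ^ 2 / 2) * Real.exp (-y ^ 2 / 16) := by ring
      _ ≤ 8 / t * Real.exp (-t ^ 2 / 2) * Real.exp (-(x - t) ^ 2 / 16) := by
          gcongr

lemma garrote_excess_mul_exp_le {t : ℝ} (ht : 0 < t) (m x : ℝ) :
    (garrote t x * (garrote t x - 2 * m)) * Real.exp (-(x - m) ^ 2 / 2) ≤
      8 / t * Real.exp (-t ^ 2 / 2) *
        (Real.exp (-(x - t) ^ 2 / 16) + Real.exp (-(x + t) ^ 2 / 16)) := by
  have hc : 0 ≤ 8 / t * Real.exp (-t ^ 2 / 2) := by positivity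
  have h1 : 0 ≤ 8 / t * Real.exp (-t ^ 2 / 2) * Real.exp (-(x - t) ^ 2 / 16) := by positivity
  have h2 : 0 ≤ 8 / t * Real.exp (-t ^ 2 / 2) * Real.exp (-(x + t) ^ 2 / 16) := by positivity
  rw [mul_add]
  rcases le_total |x| t with h | h
  · rw [garrote_of_abs_le h]
    simp only [zero_mul]
    linarith
  · rcases le_abs.1 h with h | h
    · linarith [garrote_excess_mul_exp_le_of_le m ht h]
    · have := garrote_excess_mul_exp_le_of_le (-m) ht h
      rw [garrote_neg, show (-x - -m) ^ 2 = (x - m) ^ 2 by ring,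
        show (-x - t) ^ 2 = (x + t) ^ 2 by ring] at this
      linarith

lemma integrable_sub_mean_gaussianReal (m : ℝ) :
    Integrable (fun x ↦ x - m) (gaussianReal m 1) :=
  ((memLp_id_gaussianReal 1).integrable le_rfl).sub (integrable_const m)

lemma integral_sub_mean_gaussianReal (m : ℝ) : ∫ x, (x - m) ∂gaussianReal m 1 = 0 := by
  have hi : Integrable (fun x : ℝ ↦ x) (gaussianReal m 1) :=
    (memLp_id_gaussianReal 1).integrable le_rfl
  rw [integral_sub hi (integrable_const m)]
  simp [integral_id_gaussianReal]

lemma integrable_sub_mean_sq_gaussianReal (m : ℝ) :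
    Integrable (fun x ↦ (x - m) ^ 2) (gaussianReal m 1) :=
  ((memLp_id_gaussianReal 2).sub (memLp_const m)).integrable_sq

lemma integral_sub_mean_sq_gaussianReal (m : ℝ) : ∫ x, (x - m) ^ 2 ∂gaussianReal m 1 = 1 := by
  have h := variance_id_gaussianReal (μ := m) (v := 1)
  rw [variance_eq_integral aemeasurable_id] at h
  simpa [integral_id_gaussianReal] using h

lemma garrote_risk_le_two_add {t : ℝ} (ht : 0 < t) (m : ℝ) :
    ∫ x, (garrote t x - m) ^ 2 ∂gaussianReal m 1 ≤ 2 + 2 * t ^ 2 := by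
  have hi := (integrable_sub_mean_sq_gaussianReal m).const_mul 2
  calc ∫ x, (garrote t x - m) ^ 2 ∂gaussianReal m 1
      ≤ ∫ x, (2 * (x - m) ^ 2 + 2 * t ^ 2) ∂gaussianReal m 1 := by
        refine integral_mono_of_nonneg (.of_forall fun x ↦ sq_nonneg _)
          (hi.add (integrable_const _)) (.of_forall fun x ↦ ?_)
        have := sq_garrote_sub_self_le ht x
        simp only
        nlinarith [sq_nonneg (garrote t x - x - (x - m))]
    _ = 2 + 2 * t ^ 2 := by
        rw [integral_add hi (integrable_const _), integral_const_mul,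
          integral_sub_mean_sq_gaussianReal]
        simp

lemma gaussianReal_real_Ici_add (m a : ℝ) :
    (gaussianReal m 1).real (Set.Ici (m + a)) = (gaussianReal 0 1).real (Set.Ici a) := by
  have h := gaussianReal_map_const_add (μ := 0) (v := 1) m
  rw [zero_add] at h
  rw [← h, map_measureReal_apply (by fun_prop) measurableSet_Ici]
  simp

lemma gaussianReal_real_Ici_pos (a : ℝ) : 0 < (gaussianReal 0 1).real (Set.Ici a) := by
  refine ENNReal.toReal_pos (fun h ↦ ?_) (measure_ne_top _ _)
  have := gaussianReal_absolutelyContinuous' 0 one_ne_zero h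
  simp at this

lemma garrote_risk_le_sq_threshold {t m : ℝ} (ht : 2 ≤ t)
    (hp : 3 ≤ t * (gaussianReal 0 1).real (Set.Ici 1)) (hm : t ≤ m) :
    ∫ x, (garrote t x - m) ^ 2 ∂gaussianReal m 1 ≤ t ^ 2 := by
  have ht0 : 0 < t := by linarith
  have hi2 := (integrable_sub_mean_sq_gaussianReal m).const_mul 3
  have hi1 := (integrable_sub_mean_gaussianReal m).const_mul (2 * (garrote t m - m))
  have hi0 : Integrable ((Set.Ici (m + 1)).indicator fun _ ↦ t) (gaussianReal m 1) :=
    (integrable_const t).indicator measurableSet_Ici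
  calc ∫ x, (garrote t x - m) ^ 2 ∂gaussianReal m 1
      ≤ ∫ x, (3 * (x - m) ^ 2 + 2 * (garrote t m - m) * (x - m) +
          (t ^ 2 - (Set.Ici (m + 1)).indicator (fun _ ↦ t) x)) ∂gaussianReal m 1 := by
        refine integral_mono_of_nonneg (.of_forall fun x ↦ sq_nonneg _)
          ((hi2.add hi1).add ((integrable_const _).sub hi0)) (.of_forall fun x ↦ ?_)
        have h1 := garrote_sub_mul_sub_le ht0 hm x
        have h2 : (garrote t x - x) ^ 2 ≤ t ^ 2 - (Set.Ici (m + 1)).indicator (fun _ ↦ t) x := by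
          by_cases hx : x ∈ Set.Ici (m + 1)
          · rw [Set.indicator_of_mem hx]
            rw [Set.mem_Ici] at hx
            exact sq_garrote_sub_self_le_of_add_one_le ht (by linarith)
          · rw [Set.indicator_of_notMem hx, sub_zero]
            exact sq_garrote_sub_self_le ht0 x
        simp only
        linarith
    _ = 3 + (t ^ 2 - t * (gaussianReal 0 1).real (Set.Ici 1)) := by
        have hi21 : Integrable (fun x ↦ 3 * (x - m) ^ 2 + 2 * (garrote t m - m) * (x - m))
            (gaussianReal m 1) := hi2.add hi1
        have hi3 : Integrable (fun x ↦ t ^ 2 - (Set.Ici (m + 1)).indicator (fun _ ↦ t) x)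
            (gaussianReal m 1) := (integrable_const _).sub hi0
        rw [integral_add hi21 hi3, integral_add hi2 hi1,
          integral_sub (integrable_const _) hi0, integral_const_mul, integral_const_mul,
          integral_sub_mean_sq_gaussianReal, integral_sub_mean_gaussianReal,
          integral_indicator_const _ measurableSet_Ici, gaussianReal_real_Ici_add]
        simp [mul_comm]
    _ ≤ t ^ 2 := by linarith

lemma garrote_risk_neg (t m : ℝ) :
    ∫ x, (garrote t x - -m) ^ 2 ∂gaussianReal (-m) 1 =
      ∫ x, (garrote t x - m) ^ 2 ∂gaussianReal m 1 := by
  rw [← gaussianReal_map_neg]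
  refine (integral_map_equiv (MeasurableEquiv.neg ℝ) _).trans
    (integral_congr_ae (.of_forall fun x ↦ ?_))
  change (garrote t (-x) - -m) ^ 2 = (garrote t x - m) ^ 2
  rw [garrote_neg]
  ring

lemma garrote_risk_le_sq_mean {t : ℝ} (ht : 0 < t) (m : ℝ) :
    ∫ x, (garrote t x - m) ^ 2 ∂gaussianReal m 1 ≤
      m ^ 2 + 48 * (t⁻¹ * Real.exp (-t ^ 2 / 2)) := by
  have hpdf (a x : ℝ) : Real.exp (-(x - a) ^ 2 / 16) =
      Real.sqrt (16 * Real.pi) * gaussianPDFReal a 8 x := by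
    have h16 : Real.sqrt (16 * Real.pi) ≠ 0 := by positivity
    rw [gaussianPDFReal, show 2 * Real.pi * ((8 : NNReal) : ℝ) = 16 * Real.pi by push_cast; ring,
      mul_inv_cancel_left₀ h16]
    push_cast
    norm_num
  have hs : (Real.sqrt (2 * Real.pi))⁻¹ * Real.sqrt (16 * Real.pi) ≤ 3 := by
    rw [inv_mul_le_iff₀ (by positivity)]
    refine Real.sqrt_le_iff.2 ⟨by positivity, ?_⟩
    rw [mul_pow, Real.sq_sqrt (by positivity)]
    linarith [Real.pi_pos]
  set c := t⁻¹ * Real.exp (-t ^ 2 / 2) with hc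
  have hc0 : 0 ≤ c := by positivity
  have hi0 := (integrable_gaussianPDFReal m 1).mul_const (m ^ 2)
  have hi1 := (integrable_gaussianPDFReal t 8)
  have hi2 := (integrable_gaussianPDFReal (-t) 8)
  rw [integral_gaussianReal_eq_integral_smul one_ne_zero]
  calc ∫ x, gaussianPDFReal m 1 x • (garrote t x - m) ^ 2
      ≤ ∫ x, (gaussianPDFReal m 1 x * m ^ 2 +
          24 * c * (gaussianPDFReal t 8 x + gaussianPDFReal (-t) 8 x)) := by
        refine integral_mono_of_nonneg
          (.of_forall fun x ↦ mul_nonneg (gaussianPDFReal_nonneg _ _ _) (sq_nonneg _))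
          (hi0.add ((hi1.add hi2).const_mul _)) (.of_forall fun x ↦ ?_)
        have h := garrote_excess_mul_exp_le ht m x
        have ht' := hpdf (-t) x
        rw [sub_neg_eq_add] at ht'
        rw [hpdf t, ht', ← mul_add] at h
        set P := gaussianPDFReal t 8 x + gaussianPDFReal (-t) 8 x with hP
        have hP0 : 0 ≤ P := add_nonneg (gaussianPDFReal_nonneg _ _ _) (gaussianPDFReal_nonneg _ _ _)
        have hφ : gaussianPDFReal m 1 x =
            (Real.sqrt (2 * Real.pi))⁻¹ * Real.exp (-(x - m) ^ 2 / 2) := by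
          simp [gaussianPDFReal]
        have key : gaussianPDFReal m 1 x * (garrote t x * (garrote t x - 2 * m)) ≤
            24 * c * P := by
          calc gaussianPDFReal m 1 x * (garrote t x * (garrote t x - 2 * m))
              = (Real.sqrt (2 * Real.pi))⁻¹ * ((garrote t x * (garrote t x - 2 * m)) *
                  Real.exp (-(x - m) ^ 2 / 2)) := by rw [hφ]; ring
            _ ≤ (Real.sqrt (2 * Real.pi))⁻¹ * (8 / t * Real.exp (-t ^ 2 / 2) *
                  (Real.sqrt (16 * Real.pi) * P)) := by gcongr
            _ = ((Real.sqrt (2 * Real.pi))⁻¹ * Real.sqrt (16 * Real.pi)) * (8 * c * P) := by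
                rw [hc]; ring
            _ ≤ 3 * (8 * c * P) := by gcongr
            _ = 24 * c * P := by ring
        simp only [smul_eq_mul]
        linarith
    _ = m ^ 2 + 48 * c := by
        have hi3 : Integrable fun x ↦
            24 * c * (gaussianPDFReal t 8 x + gaussianPDFReal (-t) 8 x) :=
          (hi1.add hi2).const_mul _
        rw [integral_add hi0 hi3, integral_const_mul,
          integral_add hi1 hi2, integral_mul_const, integral_gaussianPDFReal_eq_one _ one_ne_zero,
          integral_gaussianPDFReal_eq_one _ (by norm_num),
          integral_gaussianPDFReal_eq_one _ (by norm_num)]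
        ring

/-- Oracle inequality for the nonnegative garrote with threshold `λ = 2 log d`:
`E(θ̂(X) − μ)² ≤ μ² ∧ (2 log d) + C (log d)^(−1/2) d⁻¹` for an absolute constant `C > 0`. -/
theorem garrote_oracle_inequality :
    ∃ C : ℝ, 0 < C ∧ ∀ (d : ℕ), 2 ≤ d → ∀ μ : ℝ,
      (∫ x, ((max (1 - 2 * Real.log d / x ^ 2) 0) * x - μ) ^ 2 ∂(gaussianReal μ 1)) ≤
        min (μ ^ 2) (2 * Real.log d) + C * (Real.log d) ^ (-(1 : ℝ) / 2) * (d : ℝ)⁻¹ := by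
  set p := (gaussianReal 0 1).real (Set.Ici 1) with hp
  have hp0 : 0 < p := gaussianReal_real_Ici_pos 1
  set T := max 2 (3 / p) with hT
  have hT2 : 2 ≤ T := le_max_left _ _
  refine ⟨48 + (2 + 2 * T ^ 2) * (T * Real.exp (T ^ 2 / 2)), by positivity, fun d hd m ↦ ?_⟩
  have hd1 : (1 : ℝ) < d := by exact_mod_cast hd
  have hlog : 0 < Real.log d := Real.log_pos hd1
  set t := Real.sqrt (2 * Real.log d) with ht_def
  have ht : 0 < t := by positivity
  have htsq : t ^ 2 = 2 * Real.log d := Real.sq_sqrt (by positivity)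
  have hexp : Real.exp (-t ^ 2 / 2) = (d : ℝ)⁻¹ := by
    rw [htsq, show -(2 * Real.log d) / 2 = -Real.log d by ring, Real.exp_neg,
      Real.exp_log (by linarith)]
  have hrate : t⁻¹ ≤ Real.log d ^ (-(1 : ℝ) / 2) := by
    rw [neg_div, Real.rpow_neg hlog.le, ← Real.sqrt_eq_rpow]
    have : 0 < Real.sqrt (Real.log d) := by positivity
    gcongr
    exact Real.sqrt_le_sqrt (by linarith)
  set K := (2 + 2 * T ^ 2) * (T * Real.exp (T ^ 2 / 2)) with hK
  have hK0 : 0 ≤ K := by positivity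
  rw [← htsq, mul_assoc]
  change ∫ x, (garrote t x - m) ^ 2 ∂gaussianReal m 1 ≤ _
  have hrem : (48 + K) * (t⁻¹ * Real.exp (-t ^ 2 / 2)) ≤
      (48 + K) * (Real.log d ^ (-(1 : ℝ) / 2) * (d : ℝ)⁻¹) := by
    rw [hexp]; gcongr
  refine le_trans ?_ (add_le_add_right hrem _)
  set c := t⁻¹ * Real.exp (-t ^ 2 / 2) with hc
  have hc0 : 0 ≤ c := by positivity
  have hKc : 0 ≤ K * c := by positivity
  rcases le_total t T with htT | hTt
  · have hKc' : 2 + 2 * t ^ 2 ≤ K * c := by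
      have h1 : 1 ≤ (T * Real.exp (T ^ 2 / 2)) * c := by
        calc (1 : ℝ) = (t * Real.exp (t ^ 2 / 2)) * c := by
              rw [hc, neg_div, Real.exp_neg]; field_simp
          _ ≤ _ := by gcongr
      calc 2 + 2 * t ^ 2 ≤ (2 + 2 * T ^ 2) * 1 := by rw [mul_one]; gcongr
        _ ≤ (2 + 2 * T ^ 2) * ((T * Real.exp (T ^ 2 / 2)) * c) := by gcongr
        _ = K * c := by rw [hK]; ring
    have hmin : 0 ≤ min (m ^ 2) (t ^ 2) := by positivity
    linarith [garrote_risk_le_two_add ht m]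
  · have ht2 : 2 ≤ t := hT2.trans hTt
    have hpt : 3 ≤ t * p := by
      rw [← div_le_iff₀ hp0]
      exact (le_max_right _ _).trans hTt
    rcases le_total |m| t with h | h
    · rw [min_eq_left (sq_le_sq.2 (by rwa [abs_of_pos ht]))]
      linarith [garrote_risk_le_sq_mean ht m]
    · rw [min_eq_right (sq_le_sq.2 (by rwa [abs_of_pos ht]))]
      have hbound : ∫ x, (garrote t x - m) ^ 2 ∂gaussianReal m 1 ≤ t ^ 2 := by
        rcases le_abs.1 h with h | h
        · exact garrote_risk_le_sq_threshold ht2 hpt h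
        · rw [← garrote_risk_neg]
          exact garrote_risk_le_sq_threshold ht2 hpt h
      linarith
end

section
/- Let X = θ + Z ∈ ℝ^L with Z ~ N(0, I_L), L ≥ 3, and consider the James–Stein type estimator \hat{θ} = (1 − (L−2)/‖X‖²)_+ X. Then E‖\hat{θ} − θ‖² ≤ ‖θ‖²·L/(‖θ‖² + L) + 2. -/
open MeasureTheory ProbabilityTheory

section Stein

open Filter Topology

theorem integral_eq_zero_of_hasDerivAt_off_countable {F F' : ℝ → ℝ} {s : Set ℝ}
    (hs : s.Countable) (hc : Continuous F) (hd : ∀ x ∉ s, HasDerivAt F (F' x) x)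
    (hi : Integrable F') (hbot : Tendsto F atBot (𝓝 0)) (htop : Tendsto F atTop (𝓝 0)) :
    ∫ x, F' x = 0 := by
  have h1 := intervalIntegral_tendsto_integral hi tendsto_neg_atTop_atBot tendsto_id
  have h2 : Tendsto (fun b : ℝ => F b - F (-b)) atTop (𝓝 (0 - 0)) :=
    htop.sub (hbot.comp tendsto_neg_atTop_atBot)
  rw [sub_zero] at h2
  refine tendsto_nhds_unique (h1.congr fun b => ?_) h2
  exact integral_eq_of_hasDerivAt_off_countable F F' hs hc.continuousOn
    (fun x hx => hd x hx.2) hi.intervalIntegrable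

theorem hasDerivAt_gaussianPDFReal_zero_one (x : ℝ) :
    HasDerivAt (gaussianPDFReal 0 1) (-x * gaussianPDFReal 0 1 x) x := by
  have h : HasDerivAt (fun y : ℝ => -(y - 0) ^ 2 / (2 * ((1 : NNReal) : ℝ))) (-x) x := by
    have := ((((hasDerivAt_id x).sub_const 0).pow 2).neg).div_const (2 * ((1 : NNReal) : ℝ))
    refine this.congr_deriv ?_
    simp only [id, NNReal.coe_one]
    ring
  refine (h.exp.const_mul _).congr_deriv ?_
  rw [gaussianPDFReal]
  ring

theorem tendsto_gaussianPDFReal_zero_one {l : Filter ℝ}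
    (hl : Tendsto (fun x : ℝ => x ^ 2) l atTop) : Tendsto (gaussianPDFReal 0 1) l (𝓝 0) := by
  have h : Tendsto (fun x : ℝ => -(x - 0) ^ 2 / (2 * ((1 : NNReal) : ℝ))) l atBot := by
    have := hl.const_mul_atTop_of_neg (r := -(1 / 2)) (by norm_num)
    refine this.congr fun x => ?_
    rw [NNReal.coe_one]
    ring
  simpa [gaussianPDFReal_def] using (Real.tendsto_exp_atBot.comp h).const_mul
    (√(2 * Real.pi * ((1 : NNReal) : ℝ)))⁻¹

theorem integrable_gaussianPDFReal_smul {μ : ℝ} {v : NNReal} (hv : v ≠ 0) {g : ℝ → ℝ}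
    (hg : Integrable g (gaussianReal μ v)) :
    Integrable (fun x => gaussianPDFReal μ v x • g x) := by
  rw [gaussianReal_of_var_ne_zero _ hv, integrable_withDensity_iff_integrable_smul'
    (measurable_gaussianPDF μ v)
    (.of_forall fun _ => gaussianPDF_lt_top)] at hg
  simpa only [toReal_gaussianPDF] using hg

/-- **Stein's identity** for a bounded continuous function, differentiable off a countable set. -/
theorem integral_mul_gaussianReal_eq_integral_deriv {f f' : ℝ → ℝ} {s : Set ℝ}
    (hs : s.Countable) (hc : Continuous f) {C : ℝ} (hb : ∀ x, |f x| ≤ C)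
    (hd : ∀ x ∉ s, HasDerivAt f (f' x) x) (hi : Integrable f' (gaussianReal 0 1)) :
    ∫ x, x * f x ∂gaussianReal 0 1 = ∫ x, f' x ∂gaussianReal 0 1 := by
  have hx : Integrable (fun x : ℝ => x * f x) (gaussianReal 0 1) := by
    have h1 : Integrable (fun x : ℝ => x) (gaussianReal 0 1) :=
      (memLp_id_gaussianReal 1).integrable le_rfl
    exact h1.mul_bdd hc.aestronglyMeasurable (.of_forall hb)
  rw [eq_comm, ← sub_eq_zero, ← integral_sub hi hx,
    integral_gaussianReal_eq_integral_smul one_ne_zero]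
  have hbd : ∀ l, Tendsto (fun x : ℝ => x ^ 2) l atTop →
      Tendsto (fun x => f x * gaussianPDFReal 0 1 x) l (𝓝 0) := fun l hl => by
    refine bdd_le_mul_tendsto_zero' C (.of_forall hb) (tendsto_gaussianPDFReal_zero_one hl)
  refine integral_eq_zero_of_hasDerivAt_off_countable (F := fun x => f x * gaussianPDFReal 0 1 x)
    hs (hc.mul ?_) (fun x hxs => ?_) (integrable_gaussianPDFReal_smul one_ne_zero (hi.sub hx))
    (hbd _ ?_) (hbd _ (tendsto_pow_atTop two_ne_zero))
  · exact continuous_iff_continuousAt.2 fun x =>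
      (hasDerivAt_gaussianPDFReal_zero_one x).continuousAt
  · refine ((hd x hxs).mul (hasDerivAt_gaussianPDFReal_zero_one x)).congr_deriv ?_
    simp only [smul_eq_mul]
    ring
  · exact (tendsto_pow_atTop two_ne_zero).comp tendsto_neg_atBot_atTop |>.congr fun x => by simp

/-- Coordinatewise Stein identity for the standard Gaussian measure on `Fin n → ℝ`. -/
theorem integral_eval_mul_pi_gaussianReal {n : ℕ} (i : Fin n) {f f' : (Fin n → ℝ) → ℝ}
    (hc : Continuous f) {C : ℝ} (hb : ∀ z, |f z| ≤ C) (hm : Measurable f') {C' : ℝ}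
    (hb' : ∀ z, |f' z| ≤ C')
    (hd : ∀ z, {y | ¬ HasDerivAt (fun t => f (Function.update z i t))
      (f' (Function.update z i y)) y}.Countable) :
    ∫ z, z i * f z ∂(Measure.pi fun _ : Fin n => gaussianReal 0 1) =
      ∫ z, f' z ∂(Measure.pi fun _ : Fin n => gaussianReal 0 1) := by
  obtain _ | n := n
  · exact i.elim0
  have hp := (measurePreserving_piFinSuccAbove (fun _ : Fin (n + 1) => gaussianReal 0 1) i).symm
  have hx : Integrable (fun z : Fin (n + 1) → ℝ => z i * f z)
      (Measure.pi fun _ => gaussianReal 0 1) := by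
    have h1 : Integrable (fun z : Fin (n + 1) → ℝ => z i) (Measure.pi fun _ => gaussianReal 0 1) :=
      (measurePreserving_eval (fun _ => gaussianReal 0 1) i).integrable_comp_of_integrable
        ((memLp_id_gaussianReal 1).integrable le_rfl)
    exact h1.mul_bdd hc.aestronglyMeasurable (.of_forall hb)
  have hi' : Integrable f' (Measure.pi fun _ => gaussianReal 0 1) :=
    .of_bound hm.aestronglyMeasurable C' (.of_forall hb')
  have key : ∀ g : (Fin (n + 1) → ℝ) → ℝ, Integrable g (Measure.pi fun _ => gaussianReal 0 1) →
      ∫ z, g z ∂(Measure.pi fun _ => gaussianReal 0 1) =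
        ∫ w, ∫ y, g (i.insertNth y w) ∂gaussianReal 0 1
          ∂(Measure.pi fun _ : Fin n => gaussianReal 0 1) := fun g hg => by
    rw [← hp.integral_comp' g, integral_prod_symm]
    · rfl
    · exact hp.integrable_comp_of_integrable hg
  rw [key _ hx, key _ hi']
  refine integral_congr_ae (.of_forall fun w => ?_)
  have hcont : Continuous fun y : ℝ => (i.insertNth y w : Fin (n + 1) → ℝ) :=
    Continuous.finInsertNth (A := fun _ => ℝ) i continuous_id continuous_const
  have hdw := hd (i.insertNth 0 w)
  simp only [Fin.update_insertNth] at hdw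
  simp only [Fin.insertNth_apply_same]
  refine integral_mul_gaussianReal_eq_integral_deriv hdw (hc.comp hcont) (fun y => hb _)
    (fun y hy => not_not.1 hy) (.of_bound (hm.comp hcont.measurable).aestronglyMeasurable C'
      (.of_forall fun y => hb' _))

end Stein

section Shrinkage

/-- The squared Euclidean norm of `θ + z`. -/
def shiftNormSq {n : ℕ} (θ z : Fin n → ℝ) : ℝ := ∑ j, (θ j + z j) ^ 2

/-- The capped shrinkage factor `min 1 (c / s)`. -/
noncomputable def cappedShrink (c s : ℝ) : ℝ := c / max s c

/-- The `i`-th diagonal partial derivative of `z ↦ cappedShrink c ‖θ + z‖² • (θ + z)`. -/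
noncomputable def cappedShrinkDeriv {n : ℕ} (c : ℝ) (θ : Fin n → ℝ) (i : Fin n)
    (z : Fin n → ℝ) : ℝ :=
  if shiftNormSq θ z < c then 1
  else c / shiftNormSq θ z - 2 * c * (θ i + z i) ^ 2 / shiftNormSq θ z ^ 2

variable {n : ℕ} {c : ℝ} (θ : Fin n → ℝ)

theorem shiftNormSq_nonneg (z : Fin n → ℝ) : 0 ≤ shiftNormSq θ z :=
  Finset.sum_nonneg fun _ _ => sq_nonneg _

theorem sq_le_shiftNormSq (z : Fin n → ℝ) (i : Fin n) : (θ i + z i) ^ 2 ≤ shiftNormSq θ z :=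
  Finset.single_le_sum (f := fun j => (θ j + z j) ^ 2) (fun _ _ => sq_nonneg _)
    (Finset.mem_univ i)

theorem shiftNormSq_eq (z : Fin n → ℝ) :
    shiftNormSq θ z = ∑ j, θ j ^ 2 + ∑ j, z j ^ 2 + 2 * ∑ j, θ j * z j := by
  rw [shiftNormSq, Finset.mul_sum, ← Finset.sum_add_distrib, ← Finset.sum_add_distrib]
  exact Finset.sum_congr rfl fun j _ => by ring

theorem continuous_shiftNormSq : Continuous (shiftNormSq θ) := by
  unfold shiftNormSq
  fun_prop

theorem cappedShrink_of_le {s : ℝ} (hc : 0 < c) (h : s ≤ c) : cappedShrink c s = 1 := by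
  rw [cappedShrink, max_eq_right h, div_self hc.ne']

theorem cappedShrink_of_ge {s : ℝ} (h : c ≤ s) : cappedShrink c s = c / s := by
  rw [cappedShrink, max_eq_left h]

theorem continuous_cappedShrink (hc : 0 < c) : Continuous (cappedShrink c) :=
  continuous_const.div (continuous_id.max continuous_const) fun _ =>
    (hc.trans_le (le_max_right _ _)).ne'

theorem antitone_cappedShrink (hc : 0 < c) : Antitone (cappedShrink c) := fun _ _ h =>
  div_le_div_of_nonneg_left hc.le (hc.trans_le (le_max_right _ _)) (max_le_max_right c h)

theorem cappedShrink_nonneg (hc : 0 < c) (s : ℝ) : 0 ≤ cappedShrink c s :=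
  div_nonneg hc.le (hc.le.trans (le_max_right _ _))

theorem cappedShrink_le_one (hc : 0 < c) (s : ℝ) : cappedShrink c s ≤ 1 :=
  div_le_one_of_le₀ (le_max_right _ _) (hc.le.trans (le_max_right _ _))

theorem cappedShrink_mul_le (hc : 0 < c) (s : ℝ) : cappedShrink c s * s ≤ c := by
  rw [cappedShrink, div_mul_eq_mul_div, div_le_iff₀ (hc.trans_le (le_max_right _ _))]
  exact mul_le_mul_of_nonneg_left (le_max_left _ _) hc.le

theorem abs_cappedShrink_mul_le (hc : 0 < c) (z : Fin n → ℝ) (i : Fin n) :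
    |cappedShrink c (shiftNormSq θ z) * (θ i + z i)| ≤ √c := by
  refine Real.abs_le_sqrt ?_
  have h0 := cappedShrink_nonneg hc (shiftNormSq θ z)
  have h1 := cappedShrink_le_one hc (shiftNormSq θ z)
  have h2 := cappedShrink_mul_le hc (shiftNormSq θ z)
  calc (cappedShrink c (shiftNormSq θ z) * (θ i + z i)) ^ 2
      = cappedShrink c (shiftNormSq θ z) *
          (cappedShrink c (shiftNormSq θ z) * (θ i + z i) ^ 2) := by ring
    _ ≤ 1 * (cappedShrink c (shiftNormSq θ z) * shiftNormSq θ z) := by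
        gcongr
        exact sq_le_shiftNormSq θ z i
    _ ≤ c := by linarith

theorem abs_cappedShrinkDeriv_le (hc : 0 < c) (i : Fin n) (z : Fin n → ℝ) :
    |cappedShrinkDeriv c θ i z| ≤ 3 := by
  unfold cappedShrinkDeriv
  split_ifs with h
  · norm_num
  · rw [not_lt] at h
    have hs := hc.trans_le h
    have h1 : c / shiftNormSq θ z ≤ 1 := (div_le_one hs).2 h
    have h0 : 0 ≤ c / shiftNormSq θ z := by positivity
    have h2 : (θ i + z i) ^ 2 / shiftNormSq θ z ≤ 1 :=
      (div_le_one hs).2 (sq_le_shiftNormSq θ z i)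
    have h3 : 0 ≤ (θ i + z i) ^ 2 / shiftNormSq θ z := by positivity
    have h4 : 2 * c * (θ i + z i) ^ 2 / shiftNormSq θ z ^ 2 =
        2 * (c / shiftNormSq θ z * ((θ i + z i) ^ 2 / shiftNormSq θ z)) := by
      field_simp
    rw [h4, abs_le]
    constructor <;> nlinarith [mul_nonneg h0 h3, mul_le_one₀ h1 h3 h2]

theorem measurable_cappedShrinkDeriv (i : Fin n) : Measurable (cappedShrinkDeriv c θ i) := by
  have h := (continuous_shiftNormSq θ).measurable
  unfold cappedShrinkDeriv
  refine Measurable.ite (measurableSet_lt h measurable_const) measurable_const ?_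
  fun_prop

theorem sum_cappedShrinkDeriv (hc : 0 < c) (z : Fin n → ℝ) :
    ∑ i, cappedShrinkDeriv c θ i z =
      if shiftNormSq θ z < c then (n : ℝ) else (n - 2) * c / shiftNormSq θ z := by
  unfold cappedShrinkDeriv
  split_ifs with h
  · simp
  · have hs := hc.trans_le (not_lt.1 h)
    rw [Finset.sum_sub_distrib, ← Finset.sum_div Finset.univ fun i => 2 * c * (θ i + z i) ^ 2,
      ← Finset.mul_sum, ← shiftNormSq, Finset.sum_const, Finset.card_univ, Fintype.card_fin,
      nsmul_eq_mul]
    field_simp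

theorem shiftNormSq_update (z : Fin n → ℝ) (i : Fin n) (y : ℝ) :
    shiftNormSq θ (Function.update z i y) =
      (θ i + y) ^ 2 + ∑ j ∈ Finset.univ.erase i, (θ j + z j) ^ 2 := by
  rw [shiftNormSq, ← Finset.add_sum_erase _ _ (Finset.mem_univ i), Function.update_self]
  congr 1
  exact Finset.sum_congr rfl fun j hj => by
    rw [Function.update_of_ne (Finset.ne_of_mem_erase hj)]

theorem hasDerivAt_shiftNormSq_update (z : Fin n → ℝ) (i : Fin n) (y : ℝ) :
    HasDerivAt (fun t => shiftNormSq θ (Function.update z i t)) (2 * (θ i + y)) y := by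
  simp only [shiftNormSq_update]
  refine ((((hasDerivAt_id y).const_add (θ i)).pow 2).add_const _).congr_deriv ?_
  simp

theorem hasDerivAt_cappedShrink_mul (hc : 0 < c) (z : Fin n → ℝ) (i : Fin n) {y : ℝ}
    (hy : shiftNormSq θ (Function.update z i y) ≠ c) :
    HasDerivAt (fun t => cappedShrink c (shiftNormSq θ (Function.update z i t)) *
      (θ i + Function.update z i t i)) (cappedShrinkDeriv c θ i (Function.update z i y)) y := by
  have hS := hasDerivAt_shiftNormSq_update θ z i y
  have hx : HasDerivAt (fun t => θ i + t) 1 y := (hasDerivAt_id y).const_add (θ i)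
  simp only [Function.update_self, cappedShrinkDeriv]
  split_ifs with h
  · refine hx.congr_of_eventuallyEq ?_
    filter_upwards [hS.continuousAt.eventually (gt_mem_nhds h)] with t ht
    rw [cappedShrink_of_le hc ht.le, one_mul]
  · have h' := lt_of_le_of_ne (not_lt.1 h) hy.symm
    have hs := hc.trans h'
    refine (((hasDerivAt_const y c).div hS hs.ne').mul hx).congr_of_eventuallyEq ?_
      |>.congr_deriv ?_
    · filter_upwards [hS.continuousAt.eventually (lt_mem_nhds h')] with t ht
      simp only [Pi.mul_apply, Pi.div_apply]
      rw [cappedShrink_of_ge ht.le]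
    · simp only [Pi.div_apply]
      field_simp
      ring

theorem countable_setOf_shiftNormSq_update_eq (z : Fin n → ℝ) (i : Fin n) (c : ℝ) :
    {y | shiftNormSq θ (Function.update z i y) = c}.Countable := by
  set r := ∑ j ∈ Finset.univ.erase i, (θ j + z j) ^ 2 with hr
  refine ((Set.finite_singleton (-θ i - √(c - r))).insert (-θ i + √(c - r))).countable.mono
    fun y hy => ?_
  have hy' : (θ i + y) ^ 2 + r = c := by rw [hr, ← shiftNormSq_update]; exact hy
  have h : |θ i + y| = √(c - r) := by rw [← Real.sqrt_sq_eq_abs, ← hy', add_sub_cancel_right]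
  rcases abs_choice (θ i + y) with h' | h' <;> rw [h'] at h
  · exact .inl (by linarith)
  · exact .inr (by rw [Set.mem_singleton_iff]; linarith)

end Shrinkage

section Gaussian

variable {n : ℕ} {c : ℝ} (θ : Fin n → ℝ)

theorem memLp_two_eval_pi_gaussianReal (i : Fin n) :
    MemLp (fun z : Fin n → ℝ => z i) 2 (Measure.pi fun _ => gaussianReal 0 1) :=
  (memLp_id_gaussianReal 2).comp_measurePreserving
    (measurePreserving_eval (fun _ : Fin n => gaussianReal 0 1) i)

theorem integrable_eval_pi_gaussianReal (i : Fin n) :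
    Integrable (fun z : Fin n → ℝ => z i) (Measure.pi fun _ => gaussianReal 0 1) :=
  (memLp_two_eval_pi_gaussianReal i).integrable (by norm_num)

theorem integral_sq_eval_pi_gaussianReal (i : Fin n) :
    ∫ z : Fin n → ℝ, z i ^ 2 ∂(Measure.pi fun _ => gaussianReal 0 1) = 1 := by
  have h := integral_comp_eval (μ := fun _ : Fin n => gaussianReal 0 1) (i := i)
    (f := fun x : ℝ => x ^ 2) (by fun_prop)
  rw [h]
  have hv := variance_fun_id_gaussianReal (μ := 0) (v := 1)
  rw [variance_of_integral_eq_zero (by fun_prop) integral_id_gaussianReal] at hv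
  simpa using hv

theorem integrable_cappedShrink_mul_sum (hc : 0 < c) (v : Fin n → ℝ) :
    Integrable (fun z : Fin n → ℝ => cappedShrink c (shiftNormSq θ z) * ∑ i, v i * z i)
      (Measure.pi fun _ => gaussianReal 0 1) := by
  refine (integrable_finsetSum _ fun i _ =>
    (integrable_eval_pi_gaussianReal i).const_mul (v i)).bdd_mul (c := 1)
    ((continuous_cappedShrink hc).comp (continuous_shiftNormSq θ)).aestronglyMeasurable
    (.of_forall fun z => ?_)
  rw [Real.norm_of_nonneg (cappedShrink_nonneg hc _)]
  exact cappedShrink_le_one hc _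

theorem integral_cappedShrink_mul_inner_nonpos (hc : 0 < c) :
    ∫ z : Fin n → ℝ, cappedShrink c (shiftNormSq θ z) * ∑ i, θ i * z i
      ∂(Measure.pi fun _ => gaussianReal 0 1) ≤ 0 := by
  set γ := Measure.pi fun _ : Fin n => gaussianReal 0 1
  set F : (Fin n → ℝ) → ℝ := fun z => cappedShrink c (shiftNormSq θ z) * ∑ i, θ i * z i
  have hF : Integrable F γ := integrable_cappedShrink_mul_sum θ hc θ
  have hneg : MeasurePreserving (MeasurableEquiv.neg (Fin n → ℝ)) γ γ :=
    measurePreserving_pi _ _ fun _ => ⟨measurable_neg, by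
      have h := gaussianReal_map_neg (μ := 0) (v := 1)
      rwa [neg_zero] at h⟩
  have h1 : ∫ z, F (-z) ∂γ = ∫ z, F z ∂γ := hneg.integral_comp' F
  have h2 : ∫ z, (F z + F (-z)) ∂γ ≤ 0 := by
    refine integral_nonpos fun z => ?_
    have e1 := shiftNormSq_eq θ z
    have e2 := shiftNormSq_eq θ (-z)
    simp only [Pi.neg_apply, neg_sq, mul_neg, Finset.sum_neg_distrib] at e2
    simp only [F, Pi.neg_apply, mul_neg, Finset.sum_neg_distrib, Pi.zero_apply]
    rcases le_total 0 (∑ i, θ i * z i) with h | h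
    · nlinarith [antitone_cappedShrink hc
        (show shiftNormSq θ (-z) ≤ shiftNormSq θ z by linarith)]
    · nlinarith [antitone_cappedShrink hc
        (show shiftNormSq θ z ≤ shiftNormSq θ (-z) by linarith)]
  have hF' : Integrable (fun z => F (-z)) γ := hneg.integrable_comp_of_integrable hF
  rw [integral_add hF hF', h1] at h2
  linarith

theorem integrable_mul_cappedShrink_mul (hc : 0 < c) (i : Fin n) :
    Integrable (fun z : Fin n → ℝ => z i * (cappedShrink c (shiftNormSq θ z) * (θ i + z i)))
      (Measure.pi fun _ => gaussianReal 0 1) := by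
  refine (integrable_eval_pi_gaussianReal i).mul_bdd (Continuous.aestronglyMeasurable ?_)
    (.of_forall fun z => abs_cappedShrink_mul_le θ hc z i)
  exact ((continuous_cappedShrink hc).comp (continuous_shiftNormSq θ)).mul (by fun_prop)

theorem integrable_cappedShrinkDeriv (hc : 0 < c) (i : Fin n) :
    Integrable (cappedShrinkDeriv c θ i) (Measure.pi fun _ => gaussianReal 0 1) :=
  .of_bound (measurable_cappedShrinkDeriv θ i).aestronglyMeasurable 3
    (.of_forall (abs_cappedShrinkDeriv_le θ hc i))

theorem integral_mul_cappedShrink_mul (hc : 0 < c) (i : Fin n) :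
    ∫ z : Fin n → ℝ, z i * (cappedShrink c (shiftNormSq θ z) * (θ i + z i))
        ∂(Measure.pi fun _ => gaussianReal 0 1) =
      ∫ z, cappedShrinkDeriv c θ i z ∂(Measure.pi fun _ => gaussianReal 0 1) := by
  refine integral_eval_mul_pi_gaussianReal i
    (((continuous_cappedShrink hc).comp (continuous_shiftNormSq θ)).mul (by fun_prop))
    (fun z => abs_cappedShrink_mul_le θ hc z i) (measurable_cappedShrinkDeriv θ i)
    (abs_cappedShrinkDeriv_le θ hc i) fun z =>
      (countable_setOf_shiftNormSq_update_eq θ z i c).mono fun y hy => ?_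
  by_contra h
  exact hy (hasDerivAt_cappedShrink_mul θ hc z i h)

theorem max_one_sub_div_mul (hc : 0 < c) (z : Fin n → ℝ) (i : Fin n) :
    max (1 - c / shiftNormSq θ z) 0 * (θ i + z i) =
      (1 - cappedShrink c (shiftNormSq θ z)) * (θ i + z i) := by
  rcases (shiftNormSq_nonneg θ z).eq_or_lt with h0 | h0
  · have : θ i + z i = 0 := by
      have := sq_le_shiftNormSq θ z i
      rw [← h0] at this
      exact pow_eq_zero_iff two_ne_zero |>.1 (le_antisymm this (sq_nonneg _))
    rw [this, mul_zero, mul_zero]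
  · congr 1
    rcases le_total (shiftNormSq θ z) c with h | h
    · rw [cappedShrink_of_le hc h, sub_self, max_eq_right]
      rw [sub_nonpos, one_le_div h0]
      exact h
    · rw [cappedShrink_of_ge h, max_eq_left]
      rw [sub_nonneg, div_le_one h0]
      exact h

/-- The loss plus a multiple of a term of nonpositive mean is dominated by the unbiased estimate
of the bound `n - c ^ 2 / (‖θ‖² + c)`, where `c = n - 2`. -/
theorem loss_le_of_shrinkage (hc : 0 < c) (hn : c = n - 2) (z : Fin n → ℝ) :
    ∑ i, (max (1 - c / shiftNormSq θ z) 0 * (θ i + z i) - θ i) ^ 2 ≤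
      ∑ i, z i ^ 2
      - c ^ 2 / (∑ j, θ j ^ 2 + c)
      + c / (∑ j, θ j ^ 2 + c) * (cappedShrink c (shiftNormSq θ z) * ∑ i, θ i * z i)
      + (2 - c / (∑ j, θ j ^ 2 + c)) * ∑ i, (cappedShrinkDeriv c θ i z -
          z i * (cappedShrink c (shiftNormSq θ z) * (θ i + z i))) := by
  have ht : 0 ≤ ∑ j, θ j ^ 2 := Finset.sum_nonneg fun _ _ => sq_nonneg _
  have hS := shiftNormSq_eq θ z
  have hS0 := shiftNormSq_nonneg θ z
  rw [Finset.sum_sub_distrib, sum_cappedShrinkDeriv θ hc]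
  simp only [max_one_sub_div_mul θ hc]
  set k := cappedShrink c (shiftNormSq θ z) with hk
  set s := shiftNormSq θ z with hs
  set t := ∑ j, θ j ^ 2
  set T := ∑ j, θ j * z j with hT
  set Q := ∑ j, z j ^ 2 with hQ
  have hW : ∑ i, z i * (k * (θ i + z i)) = k * (T + Q) := by
    rw [hT, hQ, ← Finset.sum_add_distrib, Finset.mul_sum]
    exact Finset.sum_congr rfl fun i _ => by ring
  have hL : ∑ i, ((1 - k) * (θ i + z i) - θ i) ^ 2 = Q - 2 * (k * (T + Q)) + k ^ 2 * s := by
    rw [← hW, hQ, hs, shiftNormSq, Finset.mul_sum, Finset.mul_sum, ← Finset.sum_sub_distrib,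
      ← Finset.sum_add_distrib]
    exact Finset.sum_congr rfl fun i _ => by ring
  set m := c / (t + c) with hm
  have hmc : m * (t + c) = c := div_mul_cancel₀ _ (by positivity)
  have hm1 : m ≤ 1 := (div_le_one (by positivity)).2 (by linarith)
  have hm0 : 0 ≤ m := by positivity
  have hmm : c ^ 2 / (t + c) = m * c := by rw [hm]; ring
  rw [hW, hL, hmm, ← hn]
  have hTQ : T + Q = s - t - T := by linarith
  split_ifs with h
  · rw [cappedShrink_of_le hc h.le] at hk
    rw [hk]
    have : (n : ℝ) = c + 2 := by linarith
    rw [this]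
    nlinarith [mul_nonneg (sub_nonneg.2 hm1) (sub_nonneg.2 h.le)]
  · have hcs := not_lt.1 h
    have hs0 := hc.trans_le hcs
    rw [cappedShrink_of_ge hcs] at hk
    have hks : k * s = c := by rw [hk, div_mul_cancel₀ _ hs0.ne']
    have hcc : c * c / s = k * c := by rw [hk]; ring
    rw [hcc]
    refine le_of_eq ?_
    have h1 : k ^ 2 * s = k * c := by rw [pow_two, mul_assoc, hks]
    have h2 : k * (T + Q) = c - k * t - k * T := by rw [hTQ, ← hks]; ring
    rw [h1, h2]
    linear_combination k * hmc

end Gaussian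

/-- Risk bound for the positive-part James–Stein estimator with `L ≥ 3`:
`E‖θ̂ − θ‖² ≤ ‖θ‖² L/(‖θ‖² + L) + 2`. -/
theorem james_stein_risk_bound (L : ℕ) (hL : 3 ≤ L) (θ : Fin L → ℝ) :
    (∫ z : Fin L → ℝ,
        (∑ i, ((max (1 - ((L : ℝ) - 2) / (∑ j, (θ j + z j) ^ 2)) 0) * (θ i + z i)
            - θ i) ^ 2)
        ∂(Measure.pi fun _ : Fin L => gaussianReal 0 1)) ≤
      (∑ j, (θ j) ^ 2) * L / ((∑ j, (θ j) ^ 2) + L) + 2 := by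
  have hL' : (3 : ℝ) ≤ L := by exact_mod_cast hL
  obtain ⟨c, hcL⟩ : ∃ c : ℝ, c = L - 2 := ⟨_, rfl⟩
  have hc : 0 < c := by linarith
  have ht : 0 ≤ ∑ j, θ j ^ 2 := Finset.sum_nonneg fun _ _ => sq_nonneg _
  set γ := Measure.pi fun _ : Fin L => gaussianReal 0 1
  rw [← hcL]
  have hi1 : Integrable (fun z : Fin L → ℝ => ∑ i, z i ^ 2) γ :=
    integrable_finsetSum _ fun i _ => (memLp_two_eval_pi_gaussianReal i).integrable_sq
  have hi2 := integrable_cappedShrink_mul_sum θ hc θ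
  have hi3 : ∀ i ∈ Finset.univ, Integrable (fun z : Fin L → ℝ => cappedShrinkDeriv c θ i z -
      z i * (cappedShrink c (shiftNormSq θ z) * (θ i + z i))) γ := fun i _ =>
    (integrable_cappedShrinkDeriv θ hc i).sub (integrable_mul_cappedShrink_mul θ hc i)
  have hi3' := integrable_finsetSum _ hi3
  set t := ∑ j, θ j ^ 2
  set m := c / (t + c) with hm
  have hm0 : 0 ≤ m := by positivity
  have h12 : Integrable (fun z : Fin L → ℝ => ∑ i, z i ^ 2 - c ^ 2 / (t + c)) γ :=
    hi1.sub (integrable_const _)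
  have h123 : Integrable (fun z : Fin L → ℝ => ∑ i, z i ^ 2 - c ^ 2 / (t + c)
      + m * (cappedShrink c (shiftNormSq θ z) * ∑ i, θ i * z i)) γ := h12.add (hi2.const_mul m)
  have e1 : ∫ z : Fin L → ℝ, ∑ i, z i ^ 2 ∂γ = L := by
    rw [integral_finsetSum _ fun i _ => (memLp_two_eval_pi_gaussianReal i).integrable_sq]
    simp [integral_sq_eval_pi_gaussianReal]
  have e3 : ∫ z : Fin L → ℝ, ∑ i, (cappedShrinkDeriv c θ i z -
      z i * (cappedShrink c (shiftNormSq θ z) * (θ i + z i))) ∂γ = 0 := by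
    rw [integral_finsetSum _ hi3]
    refine Finset.sum_eq_zero fun i _ => ?_
    rw [integral_sub (integrable_cappedShrinkDeriv θ hc i)
      (integrable_mul_cappedShrink_mul θ hc i), integral_mul_cappedShrink_mul θ hc i, sub_self]
  calc _ ≤ ∫ z : Fin L → ℝ, (∑ i, z i ^ 2 - c ^ 2 / (t + c)
        + m * (cappedShrink c (shiftNormSq θ z) * ∑ i, θ i * z i)
        + (2 - m) * ∑ i, (cappedShrinkDeriv c θ i z -
          z i * (cappedShrink c (shiftNormSq θ z) * (θ i + z i)))) ∂γ :=
        integral_mono_of_nonneg (.of_forall fun z => Finset.sum_nonneg fun _ _ => sq_nonneg _)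
          (h123.add (hi3'.const_mul _))
          (.of_forall fun z => loss_le_of_shrinkage θ hc hcL z)
    _ = L - c ^ 2 / (t + c) + m * ∫ z : Fin L → ℝ,
          cappedShrink c (shiftNormSq θ z) * ∑ i, θ i * z i ∂γ := by
        rw [integral_add h123 (hi3'.const_mul _), integral_const_mul, e3,
          integral_add h12 (hi2.const_mul m), integral_const_mul,
          integral_sub hi1 (integrable_const _), e1]
        simp
    _ ≤ L - c ^ 2 / (t + c) := by
        linarith [mul_nonpos_of_nonneg_of_nonpos hm0 (integral_cappedShrink_mul_inner_nonpos θ hc)]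
    _ = c * t / (t + c) + 2 := by
        have : (L : ℝ) = c + 2 := by linarith
        rw [this]
        field_simp
        ring
    _ ≤ t * L / (t + L) + 2 := by
        refine add_le_add_left ?_ 2
        rw [div_le_div_iff₀ (by positivity) (by positivity)]
        nlinarith [mul_nonneg ht (mul_nonneg ht (show (0 : ℝ) ≤ L - c by linarith))]
end
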